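/- There is no data set of type B of genus 2; that is, there are no integers n, g₀, m, a, b, c₁,…,c_m, n₁,…,n_m satisfying conditions (D1), (D2), (D3B), (D4B) with 2g₀·n + Σ_{i=1}^m (n/n_i)(n_i − 1) = 2. -/

import Mathlib

/-- A data set of type B (degree `n`), as in Parlak–Stukow:
conditions (D1), (D2), (D3B), (D4B). -/
structure DataSetB where
  n : ℤ
  g0 : ℤ
  a : ℤ
  b : ℤ
  m : ℕ
  c : Fin m → ℤ
  ni : Fin m → ℤ
  /-- (D1): `n > 1` is odd -/
  n_gt_one : 1 < n
  n_odd : Odd n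
  /-- (D1): each `nᵢ > 1` -/
  ni_gt_one : ∀ i, 1 < ni i
  /-- (D1): each `nᵢ` divides `n` -/
  ni_dvd : ∀ i, ni i ∣ n
  /-- (D2) -/
  gcd_a : Int.gcd a n = 1
  gcd_b : Int.gcd b n = 1
  gcd_c : ∀ i, Int.gcd (c i) (ni i) = 1
  /-- (D3B): `g₀ ≥ 0` -/
  g0_nonneg : 0 ≤ g0
  /-- (D3B): `b − a = ab mod n` -/
  D3B : b - a ≡ a * b [ZMOD n]
  /-- (D4B): `a + b + Σᵢ (n/nᵢ)·cᵢ = 0 mod n` -/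
  D4B : a + b + ∑ i, (n / ni i) * c i ≡ 0 [ZMOD n]

/-- The genus of a type B data set: `g = 2g₀·n + Σᵢ (n/nᵢ)(nᵢ − 1)`. -/
def DataSetB.genus (D : DataSetB) : ℤ :=
  2 * D.g0 * D.n + ∑ i, (D.n / D.ni i) * (D.ni i - 1)

/-- The contribution of a cone point of odd order `d > 1` to the genus is at least `2`. -/
lemma two_le_ediv_mul_sub_one {n d : ℤ} (hn : 0 < n) (hodd : Odd n) (hd : 1 < d) (hdvd : d ∣ n) :
    2 ≤ n / d * (d - 1) := by
  obtain ⟨k, rfl⟩ := hdvd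
  obtain ⟨r, rfl⟩ := (Int.odd_mul.1 hodd).1
  rw [Int.mul_ediv_cancel_left _ (by omega)]
  have hk : 0 < k := pos_of_mul_pos_right hn (by omega)
  have hr : 1 ≤ r := by omega
  nlinarith

/-- A cone point of odd order `d > 1` contributing exactly `2` to the genus forces `n = d = 3`. -/
lemma eq_three_of_ediv_mul_sub_one_eq_two {n d : ℤ} (hn : 0 < n) (hodd : Odd n) (hd : 1 < d)
    (hdvd : d ∣ n) (h : n / d * (d - 1) = 2) : n = 3 ∧ d = 3 := by
  obtain ⟨k, rfl⟩ := hdvd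
  obtain ⟨r, rfl⟩ := (Int.odd_mul.1 hodd).1
  rw [Int.mul_ediv_cancel_left _ (by omega)] at h
  have hk : 0 < k := pos_of_mul_pos_right hn (by omega)
  have hr : r = 1 := by nlinarith
  subst hr
  have hk1 : k = 1 := by omega
  simp [hk1]

lemma emod_three_of_gcd_eq_one {x : ℤ} (h : Int.gcd x 3 = 1) : x % 3 = 1 ∨ x % 3 = 2 := by
  have : ¬ (3 : ℤ) ∣ x := fun hx => by
    have := Int.dvd_coe_gcd hx (dvd_refl 3)
    omega
  omega

/-- For units `a`, `b` modulo `3`, `b - a ≡ a * b` forces `a + b ≡ 0`. -/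
lemma three_dvd_add_of_sub_modEq_mul {a b : ℤ} (ha : Int.gcd a 3 = 1) (hb : Int.gcd b 3 = 1)
    (h : b - a ≡ a * b [ZMOD 3]) : 3 ∣ a + b := by
  unfold Int.ModEq at h
  rw [Int.mul_emod] at h
  rcases emod_three_of_gcd_eq_one ha with ha | ha <;>
    rcases emod_three_of_gcd_eq_one hb with hb | hb <;>
    rw [ha, hb] at h <;> omega

/-- There is no data set of type B of genus 2. -/
theorem no_typeB_genus_two : ¬ ∃ D : DataSetB, D.genus = 2 := by
  rintro ⟨⟨n, g0, a, b, m, c, d, hn, hodd, hd, hdvd, ha, hb, hc, hg0, h3, h4⟩, hg⟩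
  simp only [DataSetB.genus] at hg
  have hn0 : 0 < n := by omega
  have hn3 : 3 ≤ n := by obtain ⟨r, rfl⟩ := hodd; omega
  have hsum : 2 * (m : ℤ) ≤ ∑ i, n / d i * (d i - 1) := by
    calc 2 * (m : ℤ) = ∑ _i : Fin m, (2 : ℤ) := by simp [mul_comm]
      _ ≤ _ := Finset.sum_le_sum fun i _ => two_le_ediv_mul_sub_one hn0 hodd (hd i) (hdvd i)
  have hg00 : g0 = 0 := by nlinarith
  subst hg00
  have hm : m ≤ 1 := by omega
  interval_cases m
  · simp at hg
  · simp only [Fin.sum_univ_one] at hg h4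
    obtain ⟨rfl, hd3⟩ :=
      eq_three_of_ediv_mul_sub_one_eq_two hn0 hodd (hd 0) (hdvd 0) (by linarith)
    have hc0 := hc 0
    rw [hd3] at hc0 h4
    have hab := three_dvd_add_of_sub_modEq_mul ha hb h3
    have hc3 := emod_three_of_gcd_eq_one hc0
    have h4' := Int.modEq_zero_iff_dvd.1 h4
    omega
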